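/- (i) One has the pointwise identity −Q̃''(x) + V(x)·Q̃(x) = −(1/3)·Q̃(x)⁴ for all x ∈ ℝ; consequently ∫((Q̃')² + V·Q̃²) = −(1/3)·∫Q̃⁵ < 0, so the quadratic form of L is strictly negative at Q̃ and L has a negative eigenvalue. (ii) There exist λ₀ < 0 and a twice continuously differentiable, square-integrable function φ₀ which is strictly positive on all of ℝ and satisfies −φ₀'' + V·φ₀ = λ₀·φ₀ on ℝ; moreover λ₀ is simple: every twice continuously differentiable ψ ∈ L²(ℝ) with −ψ'' + V·ψ = λ₀·ψ is a real scalar multiple of φ₀. -/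

import Mathlib

open Real MeasureTheory Filter

noncomputable def Qs (x : ℝ) : ℝ := (3/2) * (1 / Real.cosh (x/2))^2
noncomputable def Hs (x : ℝ) : ℝ := Real.tanh (x/2)
noncomputable def alphaFn (x : ℝ) : ℝ := (1/3) * (Real.sinh x + x)
noncomputable def alphaInv : ℝ → ℝ := Function.invFun alphaFn
noncomputable def Qt (x : ℝ) : ℝ := Qs (alphaInv x)
noncomputable def Ht (x : ℝ) : ℝ := Hs (alphaInv x)
noncomputable def Vpot (x : ℝ) : ℝ := 2 * (Qt x)^2 * (1 - Qt x)

theorem hasDerivAt_alphaFn (y : ℝ) : HasDerivAt alphaFn ((1 / 3) * (Real.cosh y + 1)) y :=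
  ((Real.hasDerivAt_sinh y).add (hasDerivAt_id y)).const_mul (1 / 3)

theorem strictMono_alphaFn : StrictMono alphaFn := fun a b h => by
  have := Real.sinh_lt_sinh.2 h
  unfold alphaFn
  linarith

theorem surjective_alphaFn : Function.Surjective alphaFn := by
  have hc : Continuous alphaFn :=
    continuous_iff_continuousAt.2 fun y => (hasDerivAt_alphaFn y).continuousAt
  refine hc.surjective ?_ ?_
  · refine tendsto_atTop_mono' _ ?_ (tendsto_id.const_mul_atTop (by norm_num : (0 : ℝ) < 1 / 3))
    filter_upwards [eventually_ge_atTop 0] with y hy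
    have := Real.sinh_nonneg_iff.2 hy
    simp only [alphaFn, id]
    linarith
  · refine tendsto_atBot_mono' _ ?_ (tendsto_id.const_mul_atBot (by norm_num : (0 : ℝ) < 1 / 3))
    filter_upwards [eventually_le_atBot 0] with y hy
    have := Real.sinh_nonpos_iff.2 hy
    simp only [alphaFn, id]
    linarith

theorem alphaFn_alphaInv (x : ℝ) : alphaFn (alphaInv x) = x :=
  Function.rightInverse_invFun surjective_alphaFn x

theorem alphaInv_alphaFn (y : ℝ) : alphaInv (alphaFn y) = y :=
  Function.leftInverse_invFun strictMono_alphaFn.injective y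

theorem strictMono_alphaInv : StrictMono alphaInv := fun x y h => by
  rwa [← strictMono_alphaFn.lt_iff_lt, alphaFn_alphaInv, alphaFn_alphaInv]

theorem alphaInv_neg (x : ℝ) : alphaInv (-x) = -alphaInv x := by
  apply strictMono_alphaFn.injective
  rw [alphaFn_alphaInv]
  conv_lhs => rw [← alphaFn_alphaInv x]
  simp only [alphaFn, Real.sinh_neg]
  ring

theorem Qs_eq (y : ℝ) : Qs y = 3 / (Real.cosh y + 1) := by
  have h : Real.cosh y = Real.cosh (2 * (y / 2)) := by ring_nf
  have h0 := Real.cosh_pos (y / 2)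
  rw [h, Real.cosh_two_mul, Real.sinh_sq, Qs]
  have h1 : Real.cosh (y / 2) ^ 2 + (Real.cosh (y / 2) ^ 2 - 1) + 1 = 2 * Real.cosh (y / 2) ^ 2 := by
    ring
  rw [h1]
  field_simp

theorem hasDerivAt_alphaInv (x : ℝ) : HasDerivAt alphaInv (Qt x) x := by
  have hs : Function.Surjective alphaInv := fun y => ⟨alphaFn y, alphaInv_alphaFn y⟩
  have hc := strictMono_alphaInv.monotone.continuous_of_surjective hs
  have h0 := Real.cosh_pos (alphaInv x)
  have := HasDerivAt.of_local_left_inverse hc.continuousAt (hasDerivAt_alphaFn (alphaInv x))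
    (by positivity) (Eventually.of_forall alphaFn_alphaInv)
  refine HasDerivAt.congr_deriv this ?_
  rw [Qt, Qs_eq]
  field_simp

theorem hasDerivAt_Hs (y : ℝ) : HasDerivAt Hs (Qs y / 3) y := by
  have h0 := Real.cosh_pos (y / 2)
  have hd : HasDerivAt (fun y : ℝ => y / 2) (1 / 2) y := (hasDerivAt_id y).div_const 2
  have := hd.sinh.div hd.cosh h0.ne'
  have he : Hs = fun y => Real.sinh (y / 2) / Real.cosh (y / 2) := by
    funext y
    rw [Hs, Real.tanh_eq_sinh_div_cosh]
  rw [he]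
  refine HasDerivAt.congr_deriv this ?_
  rw [Qs]
  have := Real.cosh_sq (y / 2)
  field_simp
  linarith

theorem Hs_sq (y : ℝ) : Hs y ^ 2 = 1 - 2 / 3 * Qs y := by
  have h0 := Real.cosh_pos (y / 2)
  have := Real.cosh_sq (y / 2)
  rw [Hs, Qs, Real.tanh_eq_sinh_div_cosh]
  field_simp
  linarith

theorem hasDerivAt_Qs (y : ℝ) : HasDerivAt Qs (-Hs y * Qs y) y := by
  have he : Qs = fun y => 3 / 2 * (1 - Hs y ^ 2) := by
    funext y
    rw [Hs_sq]
    ring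
  have := (((hasDerivAt_Hs y).pow 2).const_sub 1).const_mul (3 / 2)
  rw [he]
  refine HasDerivAt.congr_deriv this ?_
  rw [← he]
  push_cast
  ring

theorem hasDerivAt_Ht (x : ℝ) : HasDerivAt Ht (Qt x ^ 2 / 3) x := by
  refine HasDerivAt.congr_deriv ((hasDerivAt_Hs (alphaInv x)).comp x (hasDerivAt_alphaInv x)) ?_
  rw [Qt]
  ring

theorem hasDerivAt_Qt (x : ℝ) : HasDerivAt Qt (-Ht x * Qt x ^ 2) x := by
  refine HasDerivAt.congr_deriv ((hasDerivAt_Qs (alphaInv x)).comp x (hasDerivAt_alphaInv x)) ?_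
  rw [Qt, Ht]
  ring

theorem Ht_sq (x : ℝ) : Ht x ^ 2 = 1 - 2 / 3 * Qt x := Hs_sq _

theorem Qt_pos (x : ℝ) : 0 < Qt x := by
  have := Real.cosh_pos (alphaInv x)
  rw [Qt, Qs_eq]
  positivity

theorem Qt_le (x : ℝ) : Qt x ≤ 3 / 2 := by
  linarith [Ht_sq x, sq_nonneg (Ht x)]

theorem abs_Ht_le (x : ℝ) : |Ht x| ≤ 1 :=
  abs_le_one_iff_mul_self_le_one.2 (by nlinarith [Ht_sq x, Qt_pos x])

theorem Qt_neg (x : ℝ) : Qt (-x) = Qt x := by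
  rw [Qt, Qt, alphaInv_neg, Qs_eq, Qs_eq, Real.cosh_neg]

theorem Ht_zero : Ht 0 = 0 := by
  have h : alphaInv 0 = 0 := by
    have := alphaInv_neg 0
    rw [neg_zero] at this
    linarith
  rw [Ht, h]
  simp [Hs]

theorem continuous_Qt : Continuous Qt :=
  continuous_iff_continuousAt.2 fun x => (hasDerivAt_Qt x).continuousAt

theorem continuous_Ht : Continuous Ht :=
  continuous_iff_continuousAt.2 fun x => (hasDerivAt_Ht x).continuousAt

theorem continuous_Vpot : Continuous Vpot :=
  ((continuous_Qt.pow 2).const_mul 2).mul (continuous_const.sub continuous_Qt)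

theorem Vpot_neg (x : ℝ) : Vpot (-x) = Vpot x := by
  rw [Vpot, Vpot, Qt_neg]

theorem Vpot_nonneg {x : ℝ} (hx : alphaFn 2 ≤ x) : 0 ≤ Vpot x := by
  have h : 2 ≤ alphaInv x := by
    rw [← alphaInv_alphaFn 2]
    exact strictMono_alphaInv.monotone hx
  have h2 : 2 ≤ Real.cosh (alphaInv x) := by
    have := Real.self_le_sinh_iff.2 (by linarith : 0 ≤ alphaInv x)
    linarith [Real.sinh_lt_cosh (alphaInv x)]
  have h3 : Qt x ≤ 1 := by
    rw [Qt, Qs_eq, div_le_one (by linarith)]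
    linarith
  exact mul_nonneg (by positivity) (by linarith)

theorem abs_Vpot_le (x : ℝ) : |Vpot x| ≤ 3 := by
  have h := Qt_pos x
  have h' := Qt_le x
  rw [abs_le, Vpot]
  constructor
  · nlinarith [mul_nonneg h.le (sub_nonneg.2 h'), mul_nonneg (sq_nonneg (Qt x)) (sub_nonneg.2 h')]
  · nlinarith [mul_pos h h, mul_pos (mul_pos h h) h, mul_nonneg h.le (sq_nonneg (Qt x - 2 / 3)),
      sq_nonneg (Qt x - 2 / 3)]

theorem deriv_Qt : deriv Qt = fun x => -Ht x * Qt x ^ 2 :=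
  funext fun x => (hasDerivAt_Qt x).deriv

theorem hasDerivAt_deriv_Qt (x : ℝ) :
    HasDerivAt (fun x => -Ht x * Qt x ^ 2) (Vpot x * Qt x + 1 / 3 * Qt x ^ 4) x := by
  refine HasDerivAt.congr_deriv ((hasDerivAt_Ht x).neg.mul ((hasDerivAt_Qt x).pow 2)) ?_
  rw [Vpot]
  simp only [Pi.neg_apply]
  push_cast
  linear_combination 2 * Qt x ^ 3 * Ht_sq x

theorem neg_deriv_deriv_Qt_add (x : ℝ) :
    -(deriv (deriv Qt) x) + Vpot x * Qt x = -(1 / 3) * (Qt x) ^ 4 := by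
  rw [deriv_Qt, (hasDerivAt_deriv_Qt x).deriv]
  ring

theorem integrable_Qt_sq : Integrable fun x => Qt x ^ 2 := by
  have hi : ∀ a b, IntervalIntegrable (fun x => Qt x ^ 2) volume a b :=
    fun a b => (continuous_Qt.pow 2).intervalIntegrable a b
  refine integrable_of_intervalIntegral_norm_bounded (l := atTop) (a := fun r : ℝ => -r)
    (b := id) 6 (fun r => ?_) tendsto_neg_atTop_atBot tendsto_id (Eventually.of_forall fun r => ?_)
  · exact (continuous_Qt.pow 2).integrableOn_Ioc
  · have h : ∀ x, HasDerivAt (fun x => 3 * Ht x) (Qt x ^ 2) x := fun x => by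
      refine HasDerivAt.congr_deriv ((hasDerivAt_Ht x).const_mul 3) ?_
      ring
    simp only [Real.norm_of_nonneg (sq_nonneg (Qt _)), id]
    rw [intervalIntegral.integral_eq_sub_of_hasDerivAt (fun x _ => h x) (hi _ _)]
    have h1 := abs_le.1 (abs_Ht_le r)
    have h2 := abs_le.1 (abs_Ht_le (-r))
    linarith

theorem integrable_mul_Qt_sq {f : ℝ → ℝ} (hf : Continuous f) {C : ℝ} (hC : ∀ x, |f x| ≤ C) :
    Integrable fun x => f x * Qt x ^ 2 :=
  integrable_Qt_sq.bdd_mul hf.aestronglyMeasurable (Eventually.of_forall hC)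

theorem integrable_Qt_pow_five : Integrable fun x => Qt x ^ 5 := by
  refine (integrable_mul_Qt_sq (f := fun x => Qt x ^ 3) (continuous_Qt.pow 3)
    (C := (3 / 2) ^ 3) fun x => ?_).congr (Eventually.of_forall fun x => ?_)
  · rw [abs_of_pos (pow_pos (Qt_pos x) 3)]
    exact pow_le_pow_left₀ (Qt_pos x).le (Qt_le x) 3
  · show _ = _
    ring

theorem integral_form_Qt :
    (∫ x, ((deriv Qt x) ^ 2 + Vpot x * (Qt x) ^ 2)) = -(1 / 3) * ∫ x, (Qt x) ^ 5 := by
  have hd : ∀ x, HasDerivAt (fun x => Qt x * (-Ht x * Qt x ^ 2))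
      (((deriv Qt x) ^ 2 + Vpot x * (Qt x) ^ 2) + 1 / 3 * Qt x ^ 5) x := fun x => by
    refine HasDerivAt.congr_deriv ((hasDerivAt_Qt x).mul (hasDerivAt_deriv_Qt x)) ?_
    rw [deriv_Qt]
    ring
  have hform : Integrable fun x => (deriv Qt x) ^ 2 + Vpot x * (Qt x) ^ 2 := by
    refine Integrable.add ?_ (integrable_mul_Qt_sq continuous_Vpot abs_Vpot_le)
    refine (integrable_mul_Qt_sq (f := fun x => Ht x ^ 2 * Qt x ^ 2)
      ((continuous_Ht.pow 2).mul (continuous_Qt.pow 2)) (C := 1 * (3 / 2) ^ 2) fun x => ?_).congr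
      (Eventually.of_forall fun x => ?_)
    · rw [abs_of_nonneg (by positivity)]
      gcongr
      · nlinarith [Ht_sq x, Qt_pos x]
      · exact (Qt_pos x).le
      · exact Qt_le x
    · show _ = _
      rw [deriv_Qt]
      ring
  have hprod : Integrable fun x => Qt x * (-Ht x * Qt x ^ 2) := by
    refine (integrable_mul_Qt_sq (f := fun x => -Ht x * Qt x)
      (continuous_Ht.neg.mul continuous_Qt) (C := 1 * (3 / 2)) fun x => ?_).congr
      (Eventually.of_forall fun x => ?_)
    · rw [abs_mul, abs_neg, abs_of_pos (Qt_pos x)]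
      exact mul_le_mul (abs_Ht_le x) (Qt_le x) (Qt_pos x).le zero_le_one
    · show _ = _
      ring
  have h5 := integrable_Qt_pow_five.const_mul (1 / 3)
  have := integral_eq_zero_of_hasDerivAt_of_integrable hd (hform.add h5) hprod
  rw [integral_add hform h5, integral_const_mul] at this
  linarith

theorem integral_Qt_pow_five_pos : 0 < ∫ x, (Qt x) ^ 5 := by
  exact integral_pos_of_integrable_nonneg_nonzero (x := 0) (continuous_Qt.pow 5)
    integrable_Qt_pow_five (fun x => (pow_pos (Qt_pos x) 5).le) (pow_pos (Qt_pos 0) 5).ne'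

section LinearODE

open scoped Topology BoundedContinuousFunction

variable {P E : Type*} [TopologicalSpace P] [NormedAddCommGroup E] [NormedSpace ℝ E]

theorem norm_integral_cosh_smul_le {f : ℝ → E} {β K : ℝ} (hβ : 0 < β) (hf : ∀ s, ‖f s‖ ≤ K)
    (x : ℝ) : ‖∫ s in (0 : ℝ)..x, Real.cosh (β * s) • f s‖ ≤ K / β * Real.cosh (β * x) := by
  have hK : 0 ≤ K := (norm_nonneg _).trans (hf 0)
  have hc : Continuous fun s => K * Real.cosh (β * s) := by fun_prop
  have hd : ∀ s, HasDerivAt (fun s => K / β * Real.sinh (β * s)) (K * Real.cosh (β * s)) s := by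
    intro s
    have h : HasDerivAt (fun s => β * s) β s := by simpa using (hasDerivAt_id s).const_mul β
    refine (h.sinh.const_mul (K / β)).congr_deriv ?_
    field_simp
  have h1 : ‖∫ s in (0 : ℝ)..x, Real.cosh (β * s) • f s‖ ≤
      |∫ s in (0 : ℝ)..x, K * Real.cosh (β * s)| := by
    refine intervalIntegral.norm_integral_le_abs_of_norm_le (Eventually.of_forall fun s => ?_)
      (hc.intervalIntegrable _ _)
    rw [norm_smul, Real.norm_of_nonneg (Real.cosh_pos _).le, mul_comm]
    exact mul_le_mul_of_nonneg_right (hf s) (Real.cosh_pos _).le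
  rw [intervalIntegral.integral_eq_sub_of_hasDerivAt (fun s _ => hd s)
    (hc.intervalIntegrable _ _)] at h1
  refine h1.trans ?_
  rw [mul_zero, Real.sinh_zero, mul_zero, sub_zero, abs_mul, abs_of_nonneg (by positivity),
    Real.abs_sinh]
  gcongr
  rw [← Real.cosh_abs (β * x)]
  exact (Real.sinh_lt_cosh _).le

/-- A linear differential equation with bounded coefficient depending continuously on a parameter
has global solutions, jointly continuous in the parameter and the time variable. -/
theorem exists_global_solution_linear [CompleteSpace E] (A : P × ℝ → E →L[ℝ] E)
    (hA : Continuous A) {M : ℝ} (hM : ∀ z, ‖A z‖ ≤ M) (u₀ : E) :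
    ∃ u : P × ℝ → E, Continuous u ∧ (∀ p, u (p, 0) = u₀) ∧
      ∀ p x, HasDerivAt (fun x => u (p, x)) (A (p, x) (u (p, x))) x := by
  obtain ⟨β, hβ, hβM⟩ : ∃ β : ℝ, 0 < β ∧ M ≤ β / 2 := ⟨2 * |M| + 1, by positivity, by
    linarith [le_abs_self M]⟩
  have hAu : ∀ u : (P × ℝ) →ᵇ E, ∀ z, ‖A z (u z)‖ ≤ β / 2 * ‖u‖ := fun u z =>
    (A z).le_of_opNorm_le_of_le ((hM z).trans hβM) (u.norm_coe_le_norm z)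
  have hAc : ∀ u : (P × ℝ) →ᵇ E, Continuous fun z => Real.cosh (β * z.2) • A z (u z) := fun u => by
    have := u.continuous
    have : Continuous fun z => A z (u z) := hA.clm_apply this
    fun_prop
  let I : ((P × ℝ) →ᵇ E) → P × ℝ → E := fun u z =>
    ∫ s in (0 : ℝ)..z.2, Real.cosh (β * s) • A (z.1, s) (u (z.1, s))
  have hI : ∀ u, Continuous (I u) := fun u => by
    have := (hAc u).comp (by fun_prop : Continuous fun q : (P × ℝ) × ℝ => (q.1.1, q.2))
    exact intervalIntegral.continuous_parametric_intervalIntegral_of_continuous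
      (f := fun (z : P × ℝ) s => Real.cosh (β * s) • A (z.1, s) (u (z.1, s))) this continuous_snd
  have hTc : ∀ u, Continuous fun z : P × ℝ => (Real.cosh (β * z.2))⁻¹ • (u₀ + I u z) := fun u => by
    have h1 := hI u
    have h2 : Continuous fun z : P × ℝ => (Real.cosh (β * z.2))⁻¹ :=
      Continuous.inv₀ (by fun_prop) fun z => (Real.cosh_pos _).ne'
    fun_prop
  have hTb : ∀ u z, ‖(Real.cosh (β * z.2))⁻¹ • (u₀ + I u z)‖ ≤ ‖u₀‖ + 1 / 2 * ‖u‖ := by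
    intro u z
    have h1 := norm_integral_cosh_smul_le hβ (fun s => hAu u (z.1, s)) z.2
    have hc := Real.one_le_cosh (β * z.2)
    have h3 : β / 2 * ‖u‖ / β = 1 / 2 * ‖u‖ := by field_simp
    rw [h3] at h1
    rw [norm_smul, norm_inv, Real.norm_of_nonneg (by linarith), inv_mul_le_iff₀ (by linarith)]
    refine (norm_add_le _ _).trans ?_
    nlinarith [norm_nonneg u₀]
  let T : ((P × ℝ) →ᵇ E) → ((P × ℝ) →ᵇ E) := fun u =>
    BoundedContinuousFunction.ofNormedAddCommGroup _ (hTc u) _ (hTb u)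
  have hT : ContractingWith (1 / 2) T := by
    refine ⟨by rw [← NNReal.coe_lt_coe]; norm_num, LipschitzWith.of_dist_le_mul fun u v => ?_⟩
    rw [BoundedContinuousFunction.dist_le (by positivity)]
    intro z
    have hc := Real.cosh_pos (β * z.2)
    have h1 := norm_integral_cosh_smul_le hβ (fun s => hAu (u - v) (z.1, s)) z.2
    have h3 : β / 2 * ‖u - v‖ / β = 1 / 2 * ‖u - v‖ := by field_simp
    have h4 : I u z - I v z = ∫ s in (0 : ℝ)..z.2, Real.cosh (β * s) •
        A (z.1, s) ((u - v) (z.1, s)) := by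
      have hi : ∀ w : (P × ℝ) →ᵇ E, IntervalIntegrable
          (fun s => Real.cosh (β * s) • A (z.1, s) (w (z.1, s))) volume 0 z.2 := fun w =>
        ((hAc w).comp (by fun_prop : Continuous fun s : ℝ => (z.1, s))).intervalIntegrable _ _
      rw [← intervalIntegral.integral_sub (hi u) (hi v)]
      simp only [BoundedContinuousFunction.coe_sub, Pi.sub_apply, map_sub, smul_sub]
    rw [← h4, h3] at h1
    rw [dist_eq_norm, dist_eq_norm]
    show ‖(Real.cosh (β * z.2))⁻¹ • (u₀ + I u z) - (Real.cosh (β * z.2))⁻¹ • (u₀ + I v z)‖ ≤ _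
    rw [← smul_sub, add_sub_add_left_eq_sub, norm_smul, norm_inv, Real.norm_of_nonneg hc.le,
      inv_mul_le_iff₀ hc, mul_comm]
    simpa using h1
  obtain ⟨w, hw⟩ : ∃ w, T w = w := ⟨_, hT.fixedPoint_isFixedPt⟩
  have hwz : ∀ z, Real.cosh (β * z.2) • w z = u₀ + I w z := fun z => by
    conv_lhs => rw [← hw]
    show Real.cosh (β * z.2) • (Real.cosh (β * z.2))⁻¹ • (u₀ + I w z) = _
    rw [smul_inv_smul₀ (Real.cosh_pos _).ne']
  refine ⟨fun z => u₀ + I w z, continuous_const.add (hI w), fun p => by simp [I], fun p x => ?_⟩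
  have hc : Continuous fun s : ℝ => Real.cosh (β * s) • A (p, s) (w (p, s)) :=
    (hAc w).comp (by fun_prop : Continuous fun s : ℝ => (p, s))
  refine ((hc.integral_hasStrictDerivAt 0 x).hasDerivAt.const_add u₀).congr_deriv ?_
  show _ = A (p, x) (u₀ + I w (p, x))
  rw [← hwz, map_smul]

end LinearODE

/-- Solutions of `f'' = W f` with `f 0 = 1`, `f' 0 = 0`, jointly continuous in a parameter. -/
theorem exists_even_data_solution {P : Type*} [TopologicalSpace P] {W : P × ℝ → ℝ}
    (hW : Continuous W) {M : ℝ} (hM : ∀ z, |W z| ≤ M) :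
    ∃ f g : P × ℝ → ℝ, Continuous f ∧ Continuous g ∧ (∀ p, f (p, 0) = 1) ∧ (∀ p, g (p, 0) = 0) ∧
      (∀ p x, HasDerivAt (fun x => f (p, x)) (g (p, x)) x) ∧
      ∀ p x, HasDerivAt (fun x => g (p, x)) (W (p, x) * f (p, x)) x := by
  let B : ℝ × ℝ →L[ℝ] ℝ × ℝ := (ContinuousLinearMap.snd ℝ ℝ ℝ).prod 0
  let C : ℝ × ℝ →L[ℝ] ℝ × ℝ :=
    (0 : ℝ × ℝ →L[ℝ] ℝ).prod (ContinuousLinearMap.fst ℝ ℝ ℝ)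
  obtain ⟨u, hu, hu0, hud⟩ := exists_global_solution_linear (fun z => B + W z • C)
    (continuous_const.add (hW.smul continuous_const)) (M := ‖B‖ + M * ‖C‖) (fun z => by
      refine (norm_add_le _ _).trans ?_
      rw [norm_smul, Real.norm_eq_abs]
      gcongr
      exact hM z) (1, 0)
  refine ⟨fun z => (u z).1, fun z => (u z).2, hu.fst, hu.snd, fun p => by simp [hu0],
    fun p => by simp [hu0], fun p x => ?_, fun p x => ?_⟩
  · exact ((ContinuousLinearMap.fst ℝ ℝ ℝ).hasFDerivAt.comp_hasDerivAt x (hud p x)).congr_deriv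
      (by simp [B, C])
  · exact ((ContinuousLinearMap.snd ℝ ℝ ℝ).hasFDerivAt.comp_hasDerivAt x (hud p x)).congr_deriv
      (by simp [B, C])

theorem eq_zero_of_hasDerivAt_of_eq_zero {W f g : ℝ → ℝ} {M : ℝ} (hM : ∀ x, |W x| ≤ M)
    (hf : ∀ x, HasDerivAt f (g x) x) (hg : ∀ x, HasDerivAt g (W x * f x) x) {t : ℝ}
    (hft : f t = 0) (hgt : g t = 0) (x : ℝ) : f x = 0 := by
  have hM0 : 0 ≤ M := (abs_nonneg _).trans (hM 0)
  have := ODE_solution_unique_univ (v := fun t (y : ℝ × ℝ) => (y.2, W t * y.1))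
    (s := fun _ => Set.univ) (K := (max 1 M).toNNReal) (t₀ := t) (f := fun x => (f x, g x))
    (g := fun _ => (0, 0)) (fun t => LipschitzOnWith.of_dist_le_mul fun y _ z _ => ?_)
    (fun x => ⟨(hf x).prodMk (hg x), trivial⟩)
    (fun x => ⟨(hasDerivAt_const x ((0, 0) : ℝ × ℝ)).congr_deriv (by simp; rfl), trivial⟩)
    (by simp [hft, hgt])
  · simpa using congrArg Prod.fst (congrFun this x)
  · rw [Real.coe_toNNReal _ (by positivity), Prod.dist_eq, Prod.dist_eq]
    simp only [Real.dist_eq]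
    rw [← mul_sub, abs_mul]
    refine max_le ?_ ?_
    · calc |y.2 - z.2| ≤ 1 * max |y.1 - z.1| |y.2 - z.2| := by rw [one_mul]; exact le_max_right _ _
        _ ≤ _ := by gcongr; exact le_max_left _ _
    · exact mul_le_mul ((hM t).trans (le_max_right _ _)) (le_max_left _ _) (abs_nonneg _)
        (by positivity)

theorem le_of_hasDerivAt_nonneg {f f' : ℝ → ℝ} {b : ℝ} (hf : ∀ x, HasDerivAt f (f' x) x)
    (h : ∀ x, b ≤ x → 0 ≤ f' x) {x : ℝ} (hx : b ≤ x) : f b ≤ f x := by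
  refine monotoneOn_of_deriv_nonneg (convex_Ici b)
    (fun x _ => (hf x).continuousAt.continuousWithinAt)
    (fun x _ => (hf x).differentiableAt.differentiableWithinAt) (fun x hx => ?_)
    Set.self_mem_Ici hx hx
  rw [interior_Ici] at hx
  rw [(hf x).deriv]
  exact h x hx.le

/-- Where the potential is nonnegative, a solution with nonnegative product of value and slope
keeps increasing in absolute value. -/
theorem sq_le_sq_of_hasDerivAt {W f g : ℝ → ℝ} (hf : ∀ x, HasDerivAt f (g x) x)
    (hg : ∀ x, HasDerivAt g (W x * f x) x) {b : ℝ} (hW : ∀ x, b ≤ x → 0 ≤ W x)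
    (hb : 0 ≤ f b * g b) {x : ℝ} (hx : b ≤ x) : f b ^ 2 ≤ f x ^ 2 := by
  have h1 : ∀ x, b ≤ x → 0 ≤ f x * g x := fun x hx => hb.trans <|
    le_of_hasDerivAt_nonneg (fun x => (hf x).mul (hg x)) (fun x hx => by
      have := mul_nonneg (hW x hx) (sq_nonneg (f x))
      nlinarith [sq_nonneg (g x)]) hx
  refine le_of_hasDerivAt_nonneg (f := fun x => f x ^ 2) (fun x => (hf x).pow 2) (fun x hx => ?_) hx
  have := h1 x hx
  push_cast
  nlinarith

theorem pos_of_hasDerivAt {W f g : ℝ → ℝ} (hf : ∀ x, HasDerivAt f (g x) x)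
    (hg : ∀ x, HasDerivAt g (W x * f x) x) {b : ℝ} (hW : ∀ x, b ≤ x → 0 ≤ W x)
    (hfb : 0 < f b) (hgb : 0 ≤ g b) {x : ℝ} (hx : b ≤ x) : 0 < f x := by
  by_contra! hneg
  obtain ⟨z, hz, hz0⟩ := intermediate_value_Icc' hx
    (fun x _ => (hf x).continuousAt.continuousWithinAt) ⟨hneg, hfb.le⟩
  have := sq_le_sq_of_hasDerivAt hf hg hW (mul_nonneg hfb.le hgb) hz.1
  rw [hz0] at this
  nlinarith

/-- Eigenfunctions decay: a square-integrable solution cannot have unit Cauchy data at the left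
end of a half-line on which the potential is nonnegative. -/
theorem not_integrable_sq_of_hasDerivAt {W f g : ℝ → ℝ} (hf : ∀ x, HasDerivAt f (g x) x)
    (hg : ∀ x, HasDerivAt g (W x * f x) x) {b : ℝ} (hW : ∀ x, b ≤ x → 0 ≤ W x)
    (hfb : f b = 1) (hgb : g b = 1) : ¬ Integrable fun x => f x ^ 2 := by
  intro hi
  have h1 : IntegrableOn (fun _ : ℝ => (1 : ℝ)) (Set.Ici b) := by
    refine Integrable.mono hi.integrableOn aestronglyMeasurable_const ?_
    filter_upwards [ae_restrict_mem measurableSet_Ici] with x hx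
    have := sq_le_sq_of_hasDerivAt hf hg hW (by rw [hfb, hgb]; norm_num) hx
    rw [hfb] at this
    rw [Real.norm_of_nonneg (sq_nonneg _), norm_one]
    linarith
  simp [integrableOn_const_iff] at h1

theorem pos_of_nonneg_of_hasDerivAt {W f g : ℝ → ℝ} {M : ℝ} (hM : ∀ x, |W x| ≤ M)
    (hf : ∀ x, HasDerivAt f (g x) x) (hg : ∀ x, HasDerivAt g (W x * f x) x) (h0 : f 0 ≠ 0)
    (h : ∀ x, 0 ≤ f x) (x : ℝ) : 0 < f x := by
  refine (h x).lt_of_ne' fun hx => h0 ?_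
  have hmin : IsLocalMin f x := Eventually.of_forall fun y => hx ▸ h y
  exact eq_zero_of_hasDerivAt_of_eq_zero hM hf hg hx (hmin.hasDerivAt_eq_zero (hf x)) 0

theorem even_of_hasDerivAt {W f g : ℝ → ℝ} {M : ℝ} (hM : ∀ x, |W x| ≤ M)
    (hW : ∀ x, W (-x) = W x) (hf : ∀ x, HasDerivAt f (g x) x)
    (hg : ∀ x, HasDerivAt g (W x * f x) x) (hg0 : g 0 = 0) (x : ℝ) : f (-x) = f x := by
  have hneg : ∀ {k k' : ℝ → ℝ}, (∀ x, HasDerivAt k (k' x) x) →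
      ∀ x, HasDerivAt (fun x => k (-x)) (-k' (-x)) x := fun hk x =>
    ((hk (-x)).scomp x (hasDerivAt_neg x)).congr_deriv (by simp)
  have := eq_zero_of_hasDerivAt_of_eq_zero (f := fun x => f x - f (-x))
    (g := fun x => g x + g (-x)) (t := 0) hM
    (fun x => ((hf x).sub (hneg hf x)).congr_deriv (by ring))
    (fun x => ((hg x).add (hneg hg x)).congr_deriv (by rw [hW]; ring)) (by simp) (by simp [hg0]) x
  linarith

/-- Comparison with `Qt`: at zero energy the even solution cannot stay positive. -/
theorem not_forall_pos_zero_energy {f g : ℝ → ℝ} (hf : ∀ x, HasDerivAt f (g x) x)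
    (hg : ∀ x, HasDerivAt g (Vpot x * f x) x) (hg0 : g 0 = 0) : ¬ ∀ x, 0 < f x := by
  intro hpos
  let w : ℝ → ℝ := fun x => g x * Qt x - f x * (-Ht x * Qt x ^ 2)
  have hw : ∀ x, HasDerivAt w (-(1 / 3 * f x * Qt x ^ 4)) x := fun x =>
    (((hg x).mul (hasDerivAt_Qt x)).sub ((hf x).mul (hasDerivAt_deriv_Qt x))).congr_deriv (by ring)
  have hw0 : w 0 = 0 := by simp [w, hg0, Ht_zero]
  have hanti : StrictAnti w := strictAnti_of_deriv_neg fun x => by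
    rw [(hw x).deriv]
    have := hpos x
    have := Qt_pos x
    exact neg_neg_of_pos (by positivity)
  have hw1 : w 1 < 0 := hw0 ▸ hanti zero_lt_one
  have hr : ∀ x, HasDerivAt (fun x => f x / Qt x) (w x / Qt x ^ 2) x := fun x =>
    (hf x).div (hasDerivAt_Qt x) (Qt_pos x).ne'
  have hbound : ∀ x, 1 ≤ x → f x / Qt x ≤ f 1 / Qt 1 + 4 / 9 * w 1 * (x - 1) := fun x hx => by
    have hlin : ∀ x : ℝ, HasDerivAt (fun x => 4 / 9 * w 1 * (x - 1)) (4 / 9 * w 1) x := fun x => by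
      simpa using ((hasDerivAt_id x).sub_const 1).const_mul (4 / 9 * w 1)
    have := le_of_hasDerivAt_nonneg (b := 1) (fun x => (hlin x).sub (hr x)) (fun x hx => by
      have h1 := hanti.antitone hx
      have h2 := Qt_pos x
      have h3 : Qt x ^ 2 ≤ 9 / 4 := by nlinarith [Qt_le x]
      rw [sub_nonneg, div_le_iff₀ (by positivity)]
      nlinarith) hx
    simp only [Pi.sub_apply] at this
    linarith
  have hr1 : 0 < f 1 / Qt 1 := div_pos (hpos 1) (Qt_pos 1)
  have hx : 1 ≤ 1 + f 1 / Qt 1 * 9 / (4 * -w 1) := by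
    have : 0 < -w 1 := by linarith
    have : 0 ≤ f 1 / Qt 1 * 9 / (4 * -w 1) := by positivity
    linarith
  have h := hbound _ hx
  have h2 : 4 / 9 * w 1 * (1 + f 1 / Qt 1 * 9 / (4 * -w 1) - 1) = -(f 1 / Qt 1) := by
    have := hw1.ne
    field_simp
    ring
  rw [h2] at h
  have := div_pos (hpos (1 + f 1 / Qt 1 * 9 / (4 * -w 1)))
    (Qt_pos (1 + f 1 / Qt 1 * 9 / (4 * -w 1)))
  linarith

/-- Shooting: at the smallest `μ` for which the even solution of `f'' = (V + μ) f` is nonnegative,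
that solution is positive, and nonincreasing far out. -/
theorem exists_ground_state : ∃ (μ : ℝ) (f g : ℝ → ℝ), 0 < μ ∧ μ ≤ 3 ∧
    (∀ x, HasDerivAt f (g x) x) ∧ (∀ x, HasDerivAt g ((Vpot x + μ) * f x) x) ∧
    (∀ x, 0 < f x) ∧ (∀ x, f (-x) = f x) ∧ ∀ x, alphaFn 2 ≤ x → g x ≤ 0 := by
  let W : ℝ × ℝ → ℝ := fun z => Vpot z.2 + max 0 (min z.1 3)
  have hWc : Continuous W := by
    have := continuous_Vpot
    fun_prop
  have hWb : ∀ z, |W z| ≤ 6 := fun z => by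
    have h1 := abs_le.1 (abs_Vpot_le z.2)
    have h2 : 0 ≤ max 0 (min z.1 3) := le_max_left _ _
    have h3 : max 0 (min z.1 3) ≤ 3 := max_le (by norm_num) (min_le_right _ _)
    rw [abs_le]
    constructor <;> simp only [W] <;> linarith
  have hWeq : ∀ {μ : ℝ}, 0 ≤ μ → μ ≤ 3 → ∀ x, W (μ, x) = Vpot x + μ := fun h0 h3 x => by
    simp only [W]
    rw [min_eq_left h3, max_eq_right h0]
  obtain ⟨f, g, hfc, hgc, hf0, hg0, hf, hg⟩ := exists_even_data_solution hWc hWb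
  have heven : ∀ μ x, f (μ, -x) = f (μ, x) := fun μ =>
    even_of_hasDerivAt (W := fun x => W (μ, x)) (fun x => hWb (μ, x))
      (fun x => by simp only [W, Vpot_neg]) (hf μ) (hg μ) (hg0 μ)
  let G : Set ℝ := {μ | μ ∈ Set.Icc 0 3 ∧ ∀ x, 0 ≤ f (μ, x)}
  have hGpos : ∀ {μ}, μ ∈ G → ∀ x, 0 < f (μ, x) := fun {μ} hμ =>
    pos_of_nonneg_of_hasDerivAt (W := fun x => W (μ, x)) (fun x => hWb (μ, x)) (hf μ) (hg μ)
      (by simp [hf0]) hμ.2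
  have hGclosed : IsClosed G := by
    have hG : G = Set.Icc 0 3 ∩ ⋂ x, {μ | 0 ≤ f (μ, x)} := by
      ext
      simp [G]
    rw [hG]
    exact isClosed_Icc.inter <| isClosed_iInter fun x => isClosed_le continuous_const (by fun_prop)
  have hG3 : (3 : ℝ) ∈ G := by
    refine ⟨by norm_num, fun x => ?_⟩
    rcases abs_choice x with h | h
    all_goals
      have h2 : 0 < f (3, |x|) := pos_of_hasDerivAt (W := fun x => W (3, x)) (hf 3) (hg 3) (b := 0)
        (fun x _ => by
          rw [hWeq (by norm_num) le_rfl]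
          linarith [(abs_le.1 (abs_Vpot_le x)).1])
        (by simp [hf0]) (by simp [hg0]) (abs_nonneg x)
      rw [h] at h2
      simpa only [heven] using h2.le
  obtain ⟨μ, hμG, hμmin⟩ :=
    (isCompact_Icc.of_isClosed_subset hGclosed fun _ h => h.1).exists_isLeast ⟨3, hG3⟩
  have hμ3 := hμG.1.2
  have hμ0 : 0 < μ := by
    refine hμG.1.1.lt_of_ne fun h => ?_
    subst h
    refine not_forall_pos_zero_energy (hf 0) (fun x => ?_) (hg0 0) (hGpos hμG)
    have := hg 0 x
    rwa [hWeq le_rfl (by norm_num), add_zero] at this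
  refine ⟨μ, fun x => f (μ, x), fun x => g (μ, x), hμ0, hμ3, hf μ, fun x => ?_, hGpos hμG,
    heven μ, fun b hb => ?_⟩
  · have := hg μ x
    rwa [hWeq hμ0.le hμ3] at this
  · by_contra! hgb
    have h1 : ∀ᶠ ν in nhds μ, ∀ x ∈ Set.Icc (-b) b, 0 < f (ν, x) :=
      isCompact_Icc.eventually_forall_of_forall_eventually fun x _ =>
        hfc.continuousAt.eventually (lt_mem_nhds (hGpos hμG x))
    have h2 : ∀ᶠ ν in nhds μ, 0 < g (ν, b) :=
      (hgc.comp (by fun_prop : Continuous fun ν : ℝ => (ν, b))).continuousAt.eventually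
        (lt_mem_nhds hgb)
    obtain ⟨ν, ⟨hν1, hν2⟩, hν0, hνμ⟩ := (((h1.and h2).filter_mono nhdsWithin_le_nhds).and
      (Ioo_mem_nhdsLT hμ0)).exists
    have hνG : ν ∈ G := by
      refine ⟨⟨hν0.le, hνμ.le.trans hμ3⟩, fun x => ?_⟩
      have hb0 : 0 ≤ b := le_trans (by unfold alphaFn; positivity) hb
      have habs : 0 < f (ν, |x|) := by
        rcases le_total |x| b with h | h
        · exact hν1 _ ⟨by linarith [abs_nonneg x], h⟩
        · refine pos_of_hasDerivAt (W := fun x => W (ν, x)) (hf ν) (hg ν) (b := b)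
            (fun x hx => ?_) (hν1 b ⟨by linarith, le_rfl⟩) hν2.le h
          rw [hWeq hν0.le (hνμ.le.trans hμ3)]
          linarith [Vpot_nonneg (hb.trans hx)]
      rcases abs_choice x with h | h
      all_goals
        rw [h] at habs
        simpa only [heven] using habs.le
    exact absurd (hμmin hνG) (not_le.2 hνμ)

theorem integrable_sq_of_decay {μ : ℝ} {V f g : ℝ → ℝ} {a : ℝ} (hμ : 0 < μ)
    (hV : ∀ x, a ≤ x → 0 ≤ V x) (hf : ∀ x, HasDerivAt f (g x) x)
    (hg : ∀ x, HasDerivAt g ((V x + μ) * f x) x) (hpos : ∀ x, 0 < f x)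
    (heven : ∀ x, f (-x) = f x) (hdec : ∀ x, a ≤ x → g x ≤ 0) :
    Integrable fun x => f x ^ 2 := by
  have hfc : Continuous f := continuous_iff_continuousAt.2 fun x => (hf x).continuousAt
  have hle : ∀ x, a ≤ x → f x ≤ f a := fun x hx => by
    have := le_of_hasDerivAt_nonneg (fun x => (hf x).neg) (fun x hx => by
      simpa using hdec x hx) hx
    simp only [Pi.neg_apply] at this
    linarith
  let F : ℝ → ℝ := fun x => ∫ s in a..x, f s ^ 2
  have hF : ∀ x, HasDerivAt F (f x ^ 2) x := fun x =>
    ((hfc.pow 2).integral_hasStrictDerivAt a x).hasDerivAt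
  have hFb : ∀ x, a ≤ x → F x ≤ f a / μ * -g a := fun x hx => by
    have h := le_of_hasDerivAt_nonneg (b := a)
      (fun x => ((hg x).const_mul (f a / μ)).sub (hF x)) (fun x hx => by
        have h1 := hpos x
        have h2 := hpos a
        have h3 : 0 ≤ f a / μ * (V x * f x) :=
          mul_nonneg (by positivity) (mul_nonneg (hV x hx) h1.le)
        have h4 : f a / μ * (μ * f x) = f a * f x := by field_simp
        nlinarith [hle x hx]) hx
    have hFa : F a = 0 := intervalIntegral.integral_same
    have h5 : f a / μ * g x ≤ 0 :=
      mul_nonpos_of_nonneg_of_nonpos (div_nonneg (hpos a).le hμ.le) (hdec x hx)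
    simp only [Pi.sub_apply, hFa] at h
    linarith
  have hIoi : IntegrableOn (fun x => f x ^ 2) (Set.Ioi a) := by
    refine integrableOn_Ioi_of_intervalIntegral_norm_bounded (l := atTop) (b := id)
      (f a / μ * -g a) a (fun r => (hfc.pow 2).integrableOn_Ioc) tendsto_id ?_
    filter_upwards [eventually_ge_atTop a] with x hx
    simp only [Real.norm_of_nonneg (sq_nonneg (f _))]
    exact hFb x hx
  have hIio : IntegrableOn (fun x => f x ^ 2) (Set.Iio (-a)) := by
    have := IntegrableOn.comp_neg_Iio (c := -a) (by rwa [neg_neg])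
    simpa only [heven] using this
  rw [← integrableOn_univ]
  have hIcc : IntegrableOn (fun x => f x ^ 2) (Set.Icc (-a) a) := (hfc.pow 2).integrableOn_Icc
  refine ((hIio.union hIcc).union hIoi).mono_set fun x _ => ?_
  simp only [Set.mem_union, Set.mem_Iio, Set.mem_Icc, Set.mem_Ioi]
  grind

/-- Square-integrable solutions form a space of dimension at most one. -/
theorem exists_eq_mul_of_integrable_sq {W f g ψ ψ' : ℝ → ℝ} {M a : ℝ} (hM : ∀ x, |W x| ≤ M)
    (hW : ∀ x, a ≤ x → 0 ≤ W x) (hf : ∀ x, HasDerivAt f (g x) x)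
    (hg : ∀ x, HasDerivAt g (W x * f x) x) (hfa : f a ≠ 0) (hfi : Integrable fun x => f x ^ 2)
    (hψ : ∀ x, HasDerivAt ψ (ψ' x) x) (hψ' : ∀ x, HasDerivAt ψ' (W x * ψ x) x)
    (hψi : Integrable fun x => ψ x ^ 2) : ∃ c : ℝ, ψ = fun x => c * f x := by
  have hfm : MemLp f 2 := (memLp_two_iff_integrable_sq
    (continuous_iff_continuousAt.2 fun x => (hf x).continuousAt).aestronglyMeasurable).2 hfi
  have hψm : MemLp ψ 2 := (memLp_two_iff_integrable_sq
    (continuous_iff_continuousAt.2 fun x => (hψ x).continuousAt).aestronglyMeasurable).2 hψi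
  have hlin : ∀ s t : ℝ, (∀ x, HasDerivAt (fun x => s * f x + t * ψ x) (s * g x + t * ψ' x) x) ∧
      (∀ x, HasDerivAt (fun x => s * g x + t * ψ' x) (W x * (s * f x + t * ψ x)) x) := fun s t =>
    ⟨fun x => ((hf x).const_mul s).add ((hψ x).const_mul t), fun x =>
      (((hg x).const_mul s).add ((hψ' x).const_mul t)).congr_deriv (by ring)⟩
  refine ⟨ψ a / f a, funext fun x => ?_⟩
  have hva : -(ψ a / f a) * f a + 1 * ψ a = 0 := by
    field_simp
    ring
  by_cases hd : -(ψ a / f a) * g a + 1 * ψ' a = 0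
  · have := eq_zero_of_hasDerivAt_of_eq_zero hM (hlin _ _).1 (hlin _ _).2 hva hd x
    linarith
  · exfalso
    set c := ψ a / f a
    set d := -c * g a + 1 * ψ' a
    let t := (1 - g a / f a) / d
    refine not_integrable_sq_of_hasDerivAt (hlin (1 / f a - t * c) t).1 (hlin _ _).2 hW ?_ ?_ ?_
    · have : (1 / f a - t * c) * f a + t * ψ a = 1 / f a * f a + t * (-c * f a + 1 * ψ a) := by ring
      rw [this, hva]
      field_simp
      ring
    · have : (1 / f a - t * c) * g a + t * ψ' a = g a / f a + t * d := by
        simp only [d]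
        ring
      rw [this]
      simp only [t]
      field_simp
      ring
    · exact ((hfm.const_mul _).add (hψm.const_mul _)).integrable_sq

/-- The quadratic form of `L = -∂ₓ² + V` is negative at `Q̃`, and
`L` has a simple negative eigenvalue with positive eigenfunction. -/
theorem L_negative_direction_and_ground_state :
    ((∀ x : ℝ, -(deriv (deriv Qt) x) + Vpot x * Qt x = -(1/3) * (Qt x)^4) ∧
      (∫ x, ((deriv Qt x)^2 + Vpot x * (Qt x)^2)) = -(1/3) * ∫ x, (Qt x)^5 ∧
      (∫ x, ((deriv Qt x)^2 + Vpot x * (Qt x)^2)) < 0) ∧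
    ∃ (lam : ℝ) (φ₀ : ℝ → ℝ), lam < 0 ∧ ContDiff ℝ 2 φ₀ ∧
      Integrable (fun x => (φ₀ x)^2) ∧ (∀ x : ℝ, 0 < φ₀ x) ∧
      (∀ x : ℝ, -(deriv (deriv φ₀) x) + Vpot x * φ₀ x = lam * φ₀ x) ∧
      (∀ ψ : ℝ → ℝ, ContDiff ℝ 2 ψ → Integrable (fun x => (ψ x)^2) →
        (∀ x : ℝ, -(deriv (deriv ψ) x) + Vpot x * ψ x = lam * ψ x) →
        ∃ c : ℝ, ψ = fun x => c * φ₀ x) := by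
  refine ⟨⟨neg_deriv_deriv_Qt_add, integral_form_Qt, ?_⟩, ?_⟩
  · rw [integral_form_Qt]
    linarith [integral_Qt_pow_five_pos]
  obtain ⟨μ, f, g, hμ0, hμ3, hf, hg, hpos, heven, hdec⟩ := exists_ground_state
  have hfi := integrable_sq_of_decay hμ0 (fun x => Vpot_nonneg) hf hg hpos heven hdec
  have hdf : deriv f = g := funext fun x => (hf x).deriv
  have hdg : deriv g = fun x => (Vpot x + μ) * f x := funext fun x => (hg x).deriv
  have hfd : Differentiable ℝ f := fun x => (hf x).differentiableAt
  have hgd : Differentiable ℝ g := fun x => (hg x).differentiableAt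
  refine ⟨-μ, f, by linarith, ?_, hfi, hpos, fun x => ?_, fun ψ hψ hψi hψeq => ?_⟩
  · rw [show (2 : WithTop ℕ∞) = 1 + 1 by norm_num, contDiff_succ_iff_deriv]
    refine ⟨hfd, by simp, ?_⟩
    rw [hdf, contDiff_one_iff_deriv, hdg]
    exact ⟨hgd, (continuous_Vpot.add continuous_const).mul hfd.continuous⟩
  · rw [hdf, hdg]
    ring
  · rw [show (2 : WithTop ℕ∞) = 1 + 1 by norm_num, contDiff_succ_iff_deriv] at hψ
    have hψ2 := hψ.2.2.differentiable one_ne_zero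
    refine exists_eq_mul_of_integrable_sq (W := fun x => Vpot x + μ) (M := 6) (a := alphaFn 2)
      (fun x => ?_) (fun x hx => by linarith [Vpot_nonneg hx]) hf hg (hpos _).ne' hfi
      (fun x => (hψ.1 x).hasDerivAt) (fun x => (hψ2 x).hasDerivAt.congr_deriv ?_) hψi
    · have := abs_le.1 (abs_Vpot_le x)
      rw [abs_le]
      constructor <;> linarith
    · linarith [hψeq x]
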